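/- arXiv:1906.03436 — 5 statements merged into one kernel-verified Lean document; each statement's English description precedes it below -/
import Mathlib

section
/- Let R be a commutative ring, L a Lie algebra over R, and S a subset of L. Then the Lie subalgebra of L generated by S coincides, as an R-submodule of L, with the R-submodule spanned by all left-normed brackets ⁅x_k, ⁅x_{k-1}, ⁅…, ⁅x_2, x_1⁆…⁆⁆⁆ with k ≥ 1 and x_1, …, x_k ∈ S (for k = 1 such a bracket is just the element x_1 itself). -/
/-- A submodule stable under bracketing with the elements of `S` is stable under bracketing with
the Lie subalgebra generated by `S`. -/
theorem lie_mem_of_mem_lieSpan {R L : Type*} [CommRing R] [LieRing L] [LieAlgebra R L]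
    {S : Set L} {p : Submodule R L} (hp : ∀ s ∈ S, ∀ y ∈ p, ⁅s, y⁆ ∈ p) {x y : L}
    (hx : x ∈ LieSubalgebra.lieSpan R L S) (hy : y ∈ p) : ⁅x, y⁆ ∈ p := by
  induction hx using LieSubalgebra.lieSpan_induction generalizing y with
  | mem s hs => exact hp s hs y hy
  | zero => simp
  | add u v _ _ hu hv => simpa only [add_lie] using p.add_mem (hu hy) (hv hy)
  | smul r u _ hu => simpa only [smul_lie] using p.smul_mem r (hu hy)
  | lie u v _ _ hu hv => simpa only [lie_lie] using p.sub_mem (hu (hv hy)) (hv (hu hy))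

/-- A Lie subalgebra contains the left-normed brackets of its elements. -/
theorem LieSubalgebra.foldl_lie_mem {R L : Type*} [CommRing R] [LieRing L] [LieAlgebra R L]
    (K : LieSubalgebra R L) {a : L} {t : List L} (ha : a ∈ K) (ht : ∀ y ∈ t, y ∈ K) :
    t.foldl (fun w y => ⁅y, w⁆) a ∈ K := by
  induction t generalizing a with
  | nil => exact ha
  | cons b t ih =>
    rw [List.forall_mem_cons] at ht
    exact ih (K.lie_mem ht.1 ha) ht.2

/-- **Rewriting lemma** (Lemma 1.7 of the paper). Over a commutative ring `R`, the Lie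
subalgebra of a Lie algebra `L` generated by a subset `S` coincides, as an `R`-submodule,
with the span of all left-normed brackets `⁅x_k, ⁅…, ⁅x₂, x₁⁆…⁆⁆` with `k ≥ 1` and all
`x_i ∈ S`.  Here such a bracket is encoded by its innermost letter `a = x₁ ∈ S` together
with the list `t = [x₂, …, x_k]` of the remaining letters, folded via `w ↦ ⁅y, w⁆`. -/
theorem lieSpan_toSubmodule_eq_span_leftNormedBrackets
    (R : Type*) [CommRing R] (L : Type*) [LieRing L] [LieAlgebra R L] (S : Set L) :
    (LieSubalgebra.lieSpan R L S).toSubmodule =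
      Submodule.span R {x : L | ∃ (a : L) (t : List L), a ∈ S ∧ (∀ y ∈ t, y ∈ S) ∧
        x = t.foldl (fun w y => ⁅y, w⁆) a} := by
  apply le_antisymm
  · intro x hx
    rw [LieSubalgebra.mem_toSubmodule] at hx
    induction hx using LieSubalgebra.lieSpan_induction with
    | mem s hs => exact Submodule.subset_span ⟨s, [], hs, by simp, rfl⟩
    | zero => exact Submodule.zero_mem _
    | add u v _ _ hu hv => exact Submodule.add_mem _ hu hv
    | smul r u _ hu => exact Submodule.smul_mem _ r hu
    | lie u v hu _ _ hv =>
      refine lie_mem_of_mem_lieSpan (fun s hs y hy => ?_) hu hv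
      induction hy using Submodule.span_induction with
      | mem w hw =>
        obtain ⟨a, t, ha, ht, rfl⟩ := hw
        refine Submodule.subset_span ⟨a, t ++ [s], ha, ?_, by simp⟩
        simpa [or_imp, forall_and] using ⟨ht, hs⟩
      | zero => simp
      | add w z _ _ hw hz => simpa only [lie_add] using Submodule.add_mem _ hw hz
      | smul r w _ hw => simpa only [lie_smul] using Submodule.smul_mem _ r hw
  · rw [Submodule.span_le]
    rintro _ ⟨a, t, ha, ht, rfl⟩
    exact LieSubalgebra.foldl_lie_mem _ (LieSubalgebra.subset_lieSpan ha)
      fun y hy => LieSubalgebra.subset_lieSpan (ht y hy)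
end

section
/- Let R be a commutative ring and X a type. The free Lie algebra FreeLieAlgebra R X is spanned as an R-module by the left-normed brackets ⁅ι(x_k), ⁅ι(x_{k-1}), ⁅…, ⁅ι(x_2), ι(x_1)⁆…⁆⁆⁆ of canonical generators, where k ≥ 1 and x_1, …, x_k ∈ X; that is, the R-submodule spanned by all such elements is the whole of FreeLieAlgebra R X. -/
namespace FreeLieAlgebra

/-- A Lie subalgebra of the free Lie algebra containing the generators is everything. -/
theorem lieSubalgebra_eq_top_of_forall_of_mem {R : Type*} [CommRing R] {X : Type*}
    (K : LieSubalgebra R (FreeLieAlgebra R X)) (hK : ∀ x, of R x ∈ K) : K = ⊤ := by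
  have h : K.incl.comp (lift R fun x => (⟨of R x, hK x⟩ : K)) = LieHom.id :=
    hom_ext fun x => by simp
  refine eq_top_iff.2 fun a _ => ?_
  have ha := LieHom.congr_fun h a
  rw [LieHom.comp_apply, LieHom.id_apply] at ha
  exact ha ▸ Subtype.property _

end FreeLieAlgebra

/-- The Lie subalgebra of elements whose adjoint action preserves a submodule. -/
def Submodule.lieStabilizer {R L : Type*} [CommRing R] [LieRing L] [LieAlgebra R L]
    (S : Submodule R L) : LieSubalgebra R L where
  carrier := {a | ∀ s ∈ S, ⁅a, s⁆ ∈ S}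
  add_mem' ha hb s hs := by
    rw [add_lie]
    exact S.add_mem (ha s hs) (hb s hs)
  zero_mem' s _ := by
    rw [zero_lie]
    exact S.zero_mem
  smul_mem' r a ha s hs := by
    rw [smul_lie]
    exact S.smul_mem r (ha s hs)
  lie_mem' ha hb s hs := by
    rw [lie_lie]
    exact S.sub_mem (ha _ (hb s hs)) (hb _ (ha s hs))

/-- A submodule of the free Lie algebra that contains the generators and is stable under
bracketing with them is everything. -/
theorem FreeLieAlgebra.submodule_eq_top_of_forall_lie_of_mem {R : Type*} [CommRing R]
    {X : Type*} (S : Submodule R (FreeLieAlgebra R X)) (hS : ∀ x, of R x ∈ S)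
    (hlie : ∀ x : X, ∀ s ∈ S, ⁅of R x, s⁆ ∈ S) : S = ⊤ := by
  have hstab : S.lieStabilizer = ⊤ := lieSubalgebra_eq_top_of_forall_of_mem _ hlie
  have hmem (a : FreeLieAlgebra R X) : a ∈ S.lieStabilizer := hstab ▸ LieSubalgebra.mem_top a
  let K : LieSubalgebra R (FreeLieAlgebra R X) :=
    { S with lie_mem' := fun {a b} _ hb => hmem a b hb }
  have hK : K = ⊤ := lieSubalgebra_eq_top_of_forall_of_mem K hS
  exact eq_top_iff.2 fun a _ => show a ∈ K from hK ▸ LieSubalgebra.mem_top a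

/-- The free Lie algebra on a type `X` over a commutative ring `R` is spanned, as an
`R`-module, by the left-normed brackets `⁅ι x_k, ⁅…, ⁅ι x₂, ι x₁⁆…⁆⁆` of canonical
generators, with `k ≥ 1` and `x_i ∈ X`.  Such a bracket is encoded by its innermost
letter `x = x₁` together with the list `t = [x₂, …, x_k]`, folded via `w ↦ ⁅ι y, w⁆`. -/
theorem freeLieAlgebra_span_leftNormedBrackets_eq_top
    (R : Type*) [CommRing R] (X : Type*) :
    Submodule.span R {z : FreeLieAlgebra R X | ∃ (x : X) (t : List X),
      z = t.foldl (fun w y => ⁅FreeLieAlgebra.of R y, w⁆) (FreeLieAlgebra.of R x)} = ⊤ := by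
  refine FreeLieAlgebra.submodule_eq_top_of_forall_lie_of_mem _
    (fun x => Submodule.subset_span ⟨x, [], rfl⟩) fun y s hs => ?_
  induction hs using Submodule.span_induction with
  | mem z hz =>
    obtain ⟨x, t, rfl⟩ := hz
    exact Submodule.subset_span ⟨x, t ++ [y], by simp⟩
  | zero => simp
  | add a b _ _ ha hb =>
    rw [lie_add]
    exact Submodule.add_mem _ ha hb
  | smul r a _ ha =>
    rw [lie_smul]
    exact Submodule.smul_mem _ r ha
end

section
/- Let R be a commutative ring and let M, N, L be Lie algebras over R. Suppose (μ : M → L, ψ_M) and (ν : N → L, ψ_N) are crossed modules of Lie algebras over R. Define ψ^M_N : M × N → N by ψ^M_N(m, n) = ψ_N(μ(m), n) and ψ^N_M : N × M → M by ψ^N_M(n, m) = ψ_M(ν(n), m). Then ψ^M_N is an action of M on N, ψ^N_M is an action of N on M, and these two actions are compatible: ψ^M_N(ψ^N_M(n, m), n') = ⁅n', ψ^M_N(m, n)⁆ and ψ^N_M(ψ^M_N(m, n), m') = ⁅m', ψ^N_M(n, m)⁆ for all m, m' ∈ M and n, n' ∈ N. -/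
universe u v w

/-- An action of a Lie algebra `L` on a Lie algebra `M` over a commutative ring `R`:
an `R`-bilinear map `act : L → M → M` satisfying
`act ⁅l,l'⁆ m = act l (act l' m) - act l' (act l m)` and
`act l ⁅m,m'⁆ = ⁅act l m, m'⁆ + ⁅m, act l m'⁆`. -/
structure LieAction (R : Type u) (L : Type v) (M : Type w) [CommRing R]
    [LieRing L] [LieAlgebra R L] [LieRing M] [LieAlgebra R M] where
  act : L → M → M
  add_left : ∀ (l l' : L) (m : M), act (l + l') m = act l m + act l' m
  smul_left : ∀ (r : R) (l : L) (m : M), act (r • l) m = r • act l m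
  add_right : ∀ (l : L) (m m' : M), act l (m + m') = act l m + act l m'
  smul_right : ∀ (r : R) (l : L) (m : M), act l (r • m) = r • act l m
  lie_act : ∀ (l l' : L) (m : M), act ⁅l, l'⁆ m = act l (act l' m) - act l' (act l m)
  act_lie : ∀ (l : L) (m m' : M), act l ⁅m, m'⁆ = ⁅act l m, m'⁆ + ⁅m, act l m'⁆

/-- A crossed module of Lie algebras `(∂ : M → L, ψ)`: the morphism `∂` is equivariant
for the action `ψ` of `L` on `M`, and the Peiffer identity holds. -/
structure IsLieCrossedModule {R : Type u} {L : Type v} {M : Type w} [CommRing R]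
    [LieRing L] [LieAlgebra R L] [LieRing M] [LieAlgebra R M]
    (d : M →ₗ⁅R⁆ L) (ψ : LieAction R L M) : Prop where
  equivariant : ∀ (l : L) (m : M), d (ψ.act l m) = ⁅l, d m⁆
  peiffer : ∀ (m m' : M), ψ.act (d m) m' = ⁅m, m'⁆

/-- Two actions of `M` on `N` and of `N` on `M` are *compatible* if
`ψMN (ψNM n m) n' = ⁅n', ψMN m n⁆` and `ψNM (ψMN m n) m' = ⁅m', ψNM n m⁆`. -/
def LieAction.Compatible {R : Type u} {M : Type v} {N : Type w} [CommRing R]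
    [LieRing M] [LieAlgebra R M] [LieRing N] [LieAlgebra R N]
    (ψMN : LieAction R M N) (ψNM : LieAction R N M) : Prop :=
  (∀ (m : M) (n n' : N), ψMN.act (ψNM.act n m) n' = ⁅n', ψMN.act m n⁆) ∧
  (∀ (n : N) (m m' : M), ψNM.act (ψMN.act m n) m' = ⁅m', ψNM.act n m⁆)

/-- The pullback of an action of `L` on `N` along a morphism of Lie algebras `M → L`. -/
def LieAction.comp {R : Type*} {L M N : Type*} [CommRing R]
    [LieRing L] [LieAlgebra R L] [LieRing M] [LieAlgebra R M] [LieRing N] [LieAlgebra R N]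
    (ψ : LieAction R L N) (f : M →ₗ⁅R⁆ L) : LieAction R M N where
  act m n := ψ.act (f m) n
  add_left m m' n := by rw [map_add, ψ.add_left]
  smul_left r m n := by rw [map_smul, ψ.smul_left]
  add_right m := ψ.add_right (f m)
  smul_right r m := ψ.smul_right r (f m)
  lie_act m m' n := by rw [LieHom.map_lie, ψ.lie_act]
  act_lie m := ψ.act_lie (f m)

theorem LieAction.neg_left {R : Type*} {L M : Type*} [CommRing R]
    [LieRing L] [LieAlgebra R L] [LieRing M] [LieAlgebra R M]
    (ψ : LieAction R L M) (l : L) (m : M) : ψ.act (-l) m = -ψ.act l m := by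
  rw [← neg_one_smul R l, ψ.smul_left, neg_one_smul]

/-- One half of the compatibility of the actions induced by two crossed modules over `L`. -/
theorem IsLieCrossedModule.act_map_act {R : Type*} {L M N : Type*} [CommRing R]
    [LieRing L] [LieAlgebra R L] [LieRing M] [LieAlgebra R M] [LieRing N] [LieAlgebra R N]
    {μ : M →ₗ⁅R⁆ L} {ψM : LieAction R L M} {ν : N →ₗ⁅R⁆ L} {ψN : LieAction R L N}
    (hM : IsLieCrossedModule μ ψM) (hN : IsLieCrossedModule ν ψN) (m : M) (n n' : N) :
    ψN.act (μ (ψM.act (ν n) m)) n' = ⁅n', ψN.act (μ m) n⁆ := by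
  rw [hM.equivariant, ← lie_skew, ← hN.equivariant, ψN.neg_left, hN.peiffer, lie_skew]

/-- Two crossed modules `(μ : M → L, ψM)` and `(ν : N → L, ψN)` over a common base `L`
induce, by composition along `μ` and `ν`, an action of `M` on `N` and an action of `N`
on `M`, and these induced actions are compatible. -/
theorem crossedModules_induce_compatible_actions
    (R : Type u) [CommRing R] (M N L : Type v)
    [LieRing M] [LieAlgebra R M] [LieRing N] [LieAlgebra R N] [LieRing L] [LieAlgebra R L]
    (μ : M →ₗ⁅R⁆ L) (ψM : LieAction R L M) (ν : N →ₗ⁅R⁆ L) (ψN : LieAction R L N)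
    (hM : IsLieCrossedModule μ ψM) (hN : IsLieCrossedModule ν ψN) :
    ∃ (ξMN : LieAction R M N) (ξNM : LieAction R N M),
      (∀ (m : M) (n : N), ξMN.act m n = ψN.act (μ m) n) ∧
      (∀ (n : N) (m : M), ξNM.act n m = ψM.act (ν n) m) ∧
      LieAction.Compatible ξMN ξNM := by
  exact ⟨ψN.comp μ, ψM.comp ν, fun _ _ => rfl, fun _ _ => rfl,
    hM.act_map_act hN, hN.act_map_act hM⟩
end

section
/- Let R be a commutative ring and let M, N be Lie algebras over R acting on each other compatibly via actions ψ^M_N of M on N and ψ^N_M of N on M. Then there exist a Lie algebra P over R, morphisms of Lie algebras l_M : M → P and l_N : N → P, and actions ξ_M of P on M and ξ_N of P on N such that: (i) (l_M : M → P, ξ_M) and (l_N : N → P, ξ_N) are crossed modules of Lie algebras; (ii) the given actions are restrictions of the P-actions, i.e. ξ_M(l_N(n), m) = ψ^N_M(n, m) and ξ_N(l_M(m), n) = ψ^M_N(m, n) for all m ∈ M, n ∈ N; (iii) P is generated as a Lie algebra by l_M(M) ∪ l_N(N); and (iv) the Peiffer relations l_M(ψ^N_M(n, m)) = ⁅l_N(n),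 l_M(m)⁆ and l_N(ψ^M_N(m, n)) = ⁅l_M(m), l_N(n)⁆ hold in P for all m ∈ M, n ∈ N. -/
universe u v w

section Derivation

variable {R : Type u} {L : Type v} {M : Type w} [CommRing R]
  [LieRing L] [LieAlgebra R L] [LieRing M] [LieAlgebra R M]

/-- A Lie action of `L` on `M` as a morphism from `L` to the Lie algebra of derivations of `M`. -/
def LieAction.toDerivation (ψ : LieAction R L M) : L →ₗ⁅R⁆ LieDerivation R M M where
  toFun l :=
    { toFun := ψ.act l
      map_add' := ψ.add_right l
      map_smul' := fun r m => ψ.smul_right r l m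
      leibniz' := fun m m' => by
        change ψ.act l ⁅m, m'⁆ = ⁅m, ψ.act l m'⁆ - ⁅m', ψ.act l m⁆
        rw [ψ.act_lie, ← lie_skew (ψ.act l m) m']
        abel }
  map_add' l l' := LieDerivation.ext fun m => ψ.add_left l l' m
  map_smul' r l := LieDerivation.ext fun m => ψ.smul_left r l m
  map_lie' {l l'} := LieDerivation.ext fun m => by
    rw [LieDerivation.lie_apply]
    exact ψ.lie_act l l' m

@[simp]
theorem LieAction.toDerivation_apply (ψ : LieAction R L M) (l : L) (m : M) :
    ψ.toDerivation l m = ψ.act l m := rfl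

/-- The Lie action defined by a morphism to the Lie algebra of derivations. -/
def LieAction.ofDerivation (f : L →ₗ⁅R⁆ LieDerivation R M M) : LieAction R L M where
  act l m := f l m
  add_left l l' m := by simp
  smul_left r l m := by simp
  add_right l m m' := by simp
  smul_right r l m := by simp
  lie_act l l' m := by simp
  act_lie l m m' := by rw [LieDerivation.apply_lie_eq_add, add_comm]

/-- The morphism out of the quotient by a Lie ideal induced by a morphism vanishing on it. -/
def LieIdeal.quotientLift {L' : Type*} [LieRing L'] [LieAlgebra R L'] (I : LieIdeal R L)
    (f : L →ₗ⁅R⁆ L') (h : I ≤ f.ker) : L ⧸ I →ₗ⁅R⁆ L' where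
  __ := I.toSubmodule.liftQ (f : L →ₗ[R] L') fun _ hx => f.mem_ker.mp (h hx)
  map_lie' {x y} := by
    induction x using Submodule.Quotient.induction_on
    induction y using Submodule.Quotient.induction_on
    exact f.map_lie _ _

end Derivation

noncomputable section PeifferProduct

variable {R : Type u} {M : Type v} {N : Type w} [CommRing R]
  [LieRing M] [LieAlgebra R M] [LieRing N] [LieAlgebra R N]
  (ψMN : LieAction R M N) (ψNM : LieAction R N M)

local notation "ιM" => fun m => FreeLieAlgebra.of R (Sum.inl m : M ⊕ N)
local notation "ιN" => fun n => FreeLieAlgebra.of R (Sum.inr n : M ⊕ N)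

/-- The relations presenting the Peiffer product on the generators `M ⊕ N`: those of the coproduct
of `M` and `N` together with the Peiffer relations. -/
inductive PeifferRel : FreeLieAlgebra R (M ⊕ N) → FreeLieAlgebra R (M ⊕ N) → Prop
  | inl_add (m m' : M) : PeifferRel (ιM (m + m')) (ιM m + ιM m')
  | inl_smul (r : R) (m : M) : PeifferRel (ιM (r • m)) (r • ιM m)
  | inl_lie (m m' : M) : PeifferRel (ιM ⁅m, m'⁆) ⁅ιM m, ιM m'⁆
  | inr_add (n n' : N) : PeifferRel (ιN (n + n')) (ιN n + ιN n')
  | inr_smul (r : R) (n : N) : PeifferRel (ιN (r • n)) (r • ιN n)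
  | inr_lie (n n' : N) : PeifferRel (ιN ⁅n, n'⁆) ⁅ιN n, ιN n'⁆
  | inl_act (n : N) (m : M) : PeifferRel (ιM (ψNM.act n m)) ⁅ιN n, ιM m⁆
  | inr_act (m : M) (n : N) : PeifferRel (ιN (ψMN.act m n)) ⁅ιM m, ιN n⁆

/-- The ideal of the free Lie algebra on `M ⊕ N` generated by the Peiffer product relations. -/
def peifferIdeal : LieIdeal R (FreeLieAlgebra R (M ⊕ N)) :=
  LieSubmodule.lieSpan R _ {x | ∃ a b, PeifferRel ψMN ψNM a b ∧ a - b = x}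

/-- The Peiffer product `M ⋈ N` of two Lie algebras acting on each other. -/
abbrev PeifferProduct : Type (max u v w) :=
  FreeLieAlgebra R (M ⊕ N) ⧸ peifferIdeal ψMN ψNM

namespace PeifferProduct

/-- The quotient map onto the Peiffer product. -/
def mk : FreeLieAlgebra R (M ⊕ N) →ₗ⁅R⁆ PeifferProduct ψMN ψNM where
  __ := (peifferIdeal ψMN ψNM).toSubmodule.mkQ
  map_lie' := rfl

theorem mk_surjective : Function.Surjective (mk ψMN ψNM) := Quot.mk_surjective

variable {ψMN ψNM} in
theorem mk_eq_of_rel {a b : FreeLieAlgebra R (M ⊕ N)} (h : PeifferRel ψMN ψNM a b) :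
    mk ψMN ψNM a = mk ψMN ψNM b :=
  (Submodule.Quotient.eq _).mpr (LieSubmodule.subset_lieSpan ⟨a, b, h, rfl⟩)

/-- The canonical morphism from `M` to the Peiffer product. -/
def inl : M →ₗ⁅R⁆ PeifferProduct ψMN ψNM where
  toFun m := mk ψMN ψNM (ιM m)
  map_add' m m' := (mk_eq_of_rel (.inl_add m m')).trans (map_add _ _ _)
  map_smul' r m := (mk_eq_of_rel (.inl_smul r m)).trans (map_smul _ _ _)
  map_lie' {m m'} := (mk_eq_of_rel (.inl_lie m m')).trans (LieHom.map_lie _ _ _)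

/-- The canonical morphism from `N` to the Peiffer product. -/
def inr : N →ₗ⁅R⁆ PeifferProduct ψMN ψNM where
  toFun n := mk ψMN ψNM (ιN n)
  map_add' n n' := (mk_eq_of_rel (.inr_add n n')).trans (map_add _ _ _)
  map_smul' r n := (mk_eq_of_rel (.inr_smul r n)).trans (map_smul _ _ _)
  map_lie' {n n'} := (mk_eq_of_rel (.inr_lie n n')).trans (LieHom.map_lie _ _ _)

theorem inl_act (n : N) (m : M) :
    inl ψMN ψNM (ψNM.act n m) = ⁅inr ψMN ψNM n, inl ψMN ψNM m⁆ :=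
  (mk_eq_of_rel (.inl_act n m)).trans (LieHom.map_lie _ _ _)

theorem inr_act (m : M) (n : N) :
    inr ψMN ψNM (ψMN.act m n) = ⁅inl ψMN ψNM m, inr ψMN ψNM n⁆ :=
  (mk_eq_of_rel (.inr_act m n)).trans (LieHom.map_lie _ _ _)

/-- The Peiffer product is generated by the images of `M` and `N`. -/
theorem lieSpan_range_eq_top :
    LieSubalgebra.lieSpan R (PeifferProduct ψMN ψNM)
      (Set.range (inl ψMN ψNM) ∪ Set.range (inr ψMN ψNM)) = ⊤ := by
  set S := LieSubalgebra.lieSpan R (PeifferProduct ψMN ψNM)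
    (Set.range (inl ψMN ψNM) ∪ Set.range (inr ψMN ψNM))
  have hS (x : M ⊕ N) : mk ψMN ψNM (FreeLieAlgebra.of R x) ∈ S :=
    LieSubalgebra.subset_lieSpan <| by
      cases x with
      | inl m => exact Or.inl ⟨m, rfl⟩
      | inr n => exact Or.inr ⟨n, rfl⟩
  have hlift : S.incl.comp (FreeLieAlgebra.lift R fun x => (⟨_, hS x⟩ : S)) = mk ψMN ψNM := by
    ext x
    simp
  refine eq_top_iff.mpr fun p _ => ?_
  obtain ⟨a, rfl⟩ := mk_surjective ψMN ψNM p
  rw [← hlift]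
  exact Subtype.property _

/-- A morphism into the Peiffer product is equivariant as soon as it is so for the elements of the
images of `M` and `N`. -/
theorem equivariant_of_generators {K : Type*} [LieRing K] [LieAlgebra R K]
    (d : K →ₗ⁅R⁆ PeifferProduct ψMN ψNM) (ξ : LieAction R (PeifferProduct ψMN ψNM) K)
    (hl : ∀ m k, d (ξ.act (inl ψMN ψNM m) k) = ⁅inl ψMN ψNM m, d k⁆)
    (hr : ∀ n k, d (ξ.act (inr ψMN ψNM n) k) = ⁅inr ψMN ψNM n, d k⁆)
    (p : PeifferProduct ψMN ψNM) (k : K) : d (ξ.act p k) = ⁅p, d k⁆ := by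
  have hp : p ∈ LieSubalgebra.lieSpan R (PeifferProduct ψMN ψNM)
      (Set.range (inl ψMN ψNM) ∪ Set.range (inr ψMN ψNM)) := by
    rw [lieSpan_range_eq_top]
    trivial
  induction hp using LieSubalgebra.lieSpan_induction generalizing k with
  | mem x hx =>
    obtain ⟨m, rfl⟩ | ⟨n, rfl⟩ := hx
    · exact hl m k
    · exact hr n k
  | zero =>
    have h : ξ.act 0 k = 0 := by simpa using ξ.smul_left 0 0 k
    rw [h, map_zero, zero_lie]
  | add x y _ _ hx hy => rw [ξ.add_left, map_add, hx, hy, add_lie]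
  | smul r x _ hx => rw [ξ.smul_left, map_smul, hx, smul_lie]
  | lie x y _ _ hx hy => rw [ξ.lie_act, map_sub, hx, hy, hy, hx, lie_lie]

variable {L : Type*} [LieRing L] [LieAlgebra R L] (f : M →ₗ⁅R⁆ L) (g : N →ₗ⁅R⁆ L)

/-- The universal property of the Peiffer product: a pair of morphisms satisfying the Peiffer
relations induces a morphism out of it. -/
def lift (hf : ∀ n m, f (ψNM.act n m) = ⁅g n, f m⁆) (hg : ∀ m n, g (ψMN.act m n) = ⁅f m, g n⁆) :
    PeifferProduct ψMN ψNM →ₗ⁅R⁆ L :=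
  LieIdeal.quotientLift _ (FreeLieAlgebra.lift R (Sum.elim f g)) <| by
    refine LieSubmodule.lieSpan_le.mpr ?_
    rintro _ ⟨a, b, h, rfl⟩
    rw [SetLike.mem_coe, LieHom.mem_ker, map_sub, sub_eq_zero]
    cases h <;> simp [hf, hg]

variable {f g} (hf : ∀ n m, f (ψNM.act n m) = ⁅g n, f m⁆)
  (hg : ∀ m n, g (ψMN.act m n) = ⁅f m, g n⁆)

@[simp]
theorem lift_inl (m : M) : lift ψMN ψNM f g hf hg (inl ψMN ψNM m) = f m :=
  FreeLieAlgebra.lift_of_apply (Sum.elim f g) (Sum.inl m)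

@[simp]
theorem lift_inr (n : N) : lift ψMN ψNM f g hf hg (inr ψMN ψNM n) = g n :=
  FreeLieAlgebra.lift_of_apply (Sum.elim f g) (Sum.inr n)

variable {ψMN ψNM} (hcomp : LieAction.Compatible ψMN ψNM)

/-- The action of the Peiffer product on `M`. -/
def actLeft : LieAction R (PeifferProduct ψMN ψNM) M :=
  .ofDerivation <| lift ψMN ψNM (LieDerivation.ad R M) ψNM.toDerivation
    (fun n m => LieDerivation.ext fun m' => by simp)
    (fun m n => LieDerivation.ext fun m' => by simp [hcomp.2])

/-- The action of the Peiffer product on `N`. -/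
def actRight : LieAction R (PeifferProduct ψMN ψNM) N :=
  .ofDerivation <| lift ψMN ψNM ψMN.toDerivation (LieDerivation.ad R N)
    (fun n m => LieDerivation.ext fun n' => by simp [hcomp.1])
    (fun m n => LieDerivation.ext fun n' => by simp)

theorem actLeft_inl (m m' : M) : (actLeft hcomp).act (inl ψMN ψNM m) m' = ⁅m, m'⁆ := by
  simp [actLeft, LieAction.ofDerivation]

theorem actLeft_inr (n : N) (m : M) :
    (actLeft hcomp).act (inr ψMN ψNM n) m = ψNM.act n m := by
  simp [actLeft, LieAction.ofDerivation]

theorem actRight_inl (m : M) (n : N) :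
    (actRight hcomp).act (inl ψMN ψNM m) n = ψMN.act m n := by
  simp [actRight, LieAction.ofDerivation]

theorem actRight_inr (n n' : N) : (actRight hcomp).act (inr ψMN ψNM n) n' = ⁅n, n'⁆ := by
  simp [actRight, LieAction.ofDerivation]

theorem isLieCrossedModule_inl : IsLieCrossedModule (inl ψMN ψNM) (actLeft hcomp) where
  equivariant := equivariant_of_generators ψMN ψNM _ _
    (fun m m' => by rw [actLeft_inl, LieHom.map_lie])
    (fun n m => by rw [actLeft_inr, inl_act])
  peiffer := actLeft_inl hcomp

theorem isLieCrossedModule_inr : IsLieCrossedModule (inr ψMN ψNM) (actRight hcomp) where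
  equivariant := equivariant_of_generators ψMN ψNM _ _
    (fun m n => by rw [actRight_inl, inr_act])
    (fun n n' => by rw [actRight_inr, LieHom.map_lie])
  peiffer := actRight_inr hcomp

end PeifferProduct

end PeifferProduct

/-- **The Peiffer product carries two crossed module structures.**
If `M` and `N` act on each other compatibly, then there is a Lie algebra `P`
(the Peiffer product `M ⋈ N`) with morphisms `lM : M → P`, `lN : N → P` and actions
`ξM`, `ξN` of `P` on `M` and `N` such that: (i) `(lM, ξM)` and `(lN, ξN)` are crossed
modules; (ii) the given actions are restrictions of the `P`-actions along `lN` and `lM`;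
(iii) `P` is generated as a Lie algebra by `lM(M) ∪ lN(N)`; (iv) the Peiffer relations
`lM (ψNM n m) = ⁅lN n, lM m⁆` and `lN (ψMN m n) = ⁅lM m, lN n⁆` hold. -/
theorem compatible_actions_give_peifferProduct_crossedModules
    (R : Type u) [CommRing R] (M N : Type v)
    [LieRing M] [LieAlgebra R M] [LieRing N] [LieAlgebra R N]
    (ψMN : LieAction R M N) (ψNM : LieAction R N M)
    (hcomp : LieAction.Compatible ψMN ψNM) :
    ∃ (P : Type (max u v)) (_ : LieRing P) (_ : LieAlgebra R P)
      (lM : M →ₗ⁅R⁆ P) (lN : N →ₗ⁅R⁆ P)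
      (ξM : LieAction R P M) (ξN : LieAction R P N),
      IsLieCrossedModule lM ξM ∧ IsLieCrossedModule lN ξN ∧
      (∀ (n : N) (m : M), ξM.act (lN n) m = ψNM.act n m) ∧
      (∀ (m : M) (n : N), ξN.act (lM m) n = ψMN.act m n) ∧
      LieSubalgebra.lieSpan R P (Set.range lM ∪ Set.range lN) = ⊤ ∧
      (∀ (m : M) (n : N), lM (ψNM.act n m) = ⁅lN n, lM m⁆) ∧
      (∀ (m : M) (n : N), lN (ψMN.act m n) = ⁅lM m, lN n⁆) := by
  exact ⟨PeifferProduct ψMN ψNM, inferInstance, inferInstance,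
    PeifferProduct.inl ψMN ψNM, PeifferProduct.inr ψMN ψNM,
    PeifferProduct.actLeft hcomp, PeifferProduct.actRight hcomp,
    PeifferProduct.isLieCrossedModule_inl hcomp, PeifferProduct.isLieCrossedModule_inr hcomp,
    PeifferProduct.actLeft_inr hcomp, PeifferProduct.actRight_inl hcomp,
    PeifferProduct.lieSpan_range_eq_top ψMN ψNM,
    fun m n => PeifferProduct.inl_act ψMN ψNM n m, PeifferProduct.inr_act ψMN ψNM⟩
end

section
/- Let R be a commutative ring, L a Lie algebra over R, and let (μ : M → L, ψ_M) and (ν : N → L, ψ_N) be crossed modules of Lie algebras over R. Then there exist a crossed module (δ : P → L, ψ_P) over L together with morphisms of crossed modules over L, ι_M : (μ : M → L, ψ_M) → (δ : P → L, ψ_P) and ι_N : (ν : N → L, ψ_N) → (δ : P → L, ψ_P), with the following universal property: for every crossed module (z : Z → L, ψ_Z) over L (with Z in the same universe as M, N and L) and every pair of morphisms of crossed modules over L, f : M → Z and g : N → Z, there exists a unique morphism of crossed modules over L, h : P → Z, such that h ∘ ι_M = f and h ∘ ι_N = g. In other words, binary coproducts exist in the category of crossed modules of Lie algebras over L, and they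 are realized by the Peiffer product. -/
universe u v w

/-- A morphism of crossed modules over a common base `L`: a Lie algebra morphism
`f : M → M'` commuting with the structure morphisms to `L` and equivariant for the
`L`-actions. -/
def IsXModHom {R : Type u} {L : Type v} {M : Type w} {M' : Type*} [CommRing R]
    [LieRing L] [LieAlgebra R L] [LieRing M] [LieAlgebra R M]
    [LieRing M'] [LieAlgebra R M']
    (d : M →ₗ⁅R⁆ L) (ψ : LieAction R L M)
    (d' : M' →ₗ⁅R⁆ L) (ψ' : LieAction R L M')
    (f : M →ₗ⁅R⁆ M') : Prop :=
  (∀ m : M, d' (f m) = d m) ∧ ∀ (l : L) (m : M), f (ψ.act l m) = ψ'.act l (f m)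

attribute [local instance] LieRing.ofAssociativeRing

/-- The representation of `L` on the underlying module of `M` given by a Lie action. -/
def LieAction.toEnd {R : Type u} {L : Type v} {M : Type w} [CommRing R]
    [LieRing L] [LieAlgebra R L] [LieRing M] [LieAlgebra R M]
    (ψ : LieAction R L M) : L →ₗ⁅R⁆ Module.End R M where
  toFun l :=
    { toFun := ψ.act l
      map_add' := ψ.add_right l
      map_smul' := fun r m => ψ.smul_right r l m }
  map_add' l l' := LinearMap.ext (ψ.add_left l l')
  map_smul' r l := LinearMap.ext (ψ.smul_left r l)
  map_lie' {l l'} := LinearMap.ext (ψ.lie_act l l')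

@[simp]
theorem LieAction.toEnd_apply {R : Type u} {L : Type v} {M : Type w} [CommRing R]
    [LieRing L] [LieAlgebra R L] [LieRing M] [LieAlgebra R M]
    (ψ : LieAction R L M) (l : L) (m : M) : ψ.toEnd l m = ψ.act l m := rfl

/-- A linear map between crossed modules over `L` that is equivariant and compatible with the
structure morphisms is automatically a morphism of Lie algebras. -/
def IsLieCrossedModule.lieHomOfLinear {R : Type*} {L : Type*} {M : Type*} {M' : Type*} [CommRing R]
    [LieRing L] [LieAlgebra R L] [LieRing M] [LieAlgebra R M] [LieRing M'] [LieAlgebra R M']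
    {d : M →ₗ⁅R⁆ L} {ψ : LieAction R L M} {d' : M' →ₗ⁅R⁆ L} {ψ' : LieAction R L M'}
    (h : IsLieCrossedModule d ψ) (h' : IsLieCrossedModule d' ψ') (f : M →ₗ[R] M')
    (hd : ∀ m, d' (f m) = d m) (hψ : ∀ l m, f (ψ.act l m) = ψ'.act l (f m)) : M →ₗ⁅R⁆ M' :=
  { f with
    map_lie' := fun {m m'} => by
      change f ⁅m, m'⁆ = ⁅f m, f m'⁆
      rw [← h.peiffer, hψ, ← hd, h'.peiffer] }

namespace PeifferRep

variable {R : Type*} {L : Type*} {Q : Type*} [CommRing R] [LieRing L] [LieAlgebra R L]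
  [AddCommGroup Q] [Module R Q] (ρ : L →ₗ⁅R⁆ Module.End R Q) (δ : Q →ₗ[R] L)
  (equivariant : ∀ l q, δ (ρ l q) = ⁅l, δ q⁆) (alternating : ∀ q, ρ (δ q) q = 0)

/-- If `δ : Q → L` is an equivariant map from a representation of `L` with `δ q • q = 0`
for all `q`, then `⁅p, q⁆ = δ p • q` is a Lie bracket on `Q`. -/
abbrev lieRing : LieRing Q where
  bracket p q := ρ (δ p) q
  add_lie p q r := by simp
  lie_add p q r := by simp
  lie_self := alternating
  leibniz_lie p q r := by simp [equivariant]

/-- The bracket `⁅p, q⁆ = δ p • q` is bilinear. -/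
abbrev lieAlgebra :
    letI := lieRing ρ δ equivariant alternating
    LieAlgebra R Q :=
  letI := lieRing ρ δ equivariant alternating
  { lie_smul := fun r p q => (ρ (δ p)).map_smul r q }

/-- The map `δ`, as a morphism of Lie algebras for the bracket `⁅p, q⁆ = δ p • q`. -/
def boundary :
    letI := lieRing ρ δ equivariant alternating
    letI := lieAlgebra ρ δ equivariant alternating
    Q →ₗ⁅R⁆ L :=
  letI := lieRing ρ δ equivariant alternating
  letI := lieAlgebra ρ δ equivariant alternating
  { δ with map_lie' := fun {p q} => equivariant (δ p) q }

/-- The representation `ρ`, as an action by derivations of the bracket `⁅p, q⁆ = δ p • q`. -/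
def action :
    letI := lieRing ρ δ equivariant alternating
    letI := lieAlgebra ρ δ equivariant alternating
    LieAction R L Q :=
  letI := lieRing ρ δ equivariant alternating
  letI := lieAlgebra ρ δ equivariant alternating
  { act := fun l q => ρ l q
    add_left := fun l l' q => by simp
    smul_left := fun r l q => by simp
    add_right := fun l q q' => by simp
    smul_right := fun r l q => by simp
    lie_act := fun l l' q => by simp
    act_lie := fun l p q => by
      change ρ l (ρ (δ p) q) = ρ (δ (ρ l p)) q + ρ (δ p) (ρ l q)
      simp [equivariant] }

theorem isLieCrossedModule :
    letI := lieRing ρ δ equivariant alternating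
    letI := lieAlgebra ρ δ equivariant alternating
    IsLieCrossedModule (boundary ρ δ equivariant alternating)
      (action ρ δ equivariant alternating) :=
  letI := lieRing ρ δ equivariant alternating
  letI := lieAlgebra ρ δ equivariant alternating
  { equivariant := equivariant
    peiffer := fun _ _ => rfl }

end PeifferRep

namespace PeifferProduct

variable {R : Type*} {L : Type*} {M : Type*} {N : Type*} [CommRing R]
  [LieRing L] [LieAlgebra R L] [LieRing M] [LieAlgebra R M] [LieRing N] [LieAlgebra R N]
  (μ : M →ₗ⁅R⁆ L) (ψM : LieAction R L M) (ν : N →ₗ⁅R⁆ L) (ψN : LieAction R L N)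

/-- The submodule of `M × N` spanned by the elements `(ν n • m, μ m • n)`. -/
def relations : Submodule R (M × N) :=
  Submodule.span R (Set.range fun x : M × N => (ψM.act (ν x.2) x.1, ψN.act (μ x.1) x.2))

variable {μ ψM ν ψN}

theorem mem_relations (m : M) (n : N) :
    (ψM.act (ν n) m, ψN.act (μ m) n) ∈ relations μ ψM ν ψN :=
  Submodule.subset_span ⟨(m, n), rfl⟩

theorem relations_le_comap (hM : IsLieCrossedModule μ ψM) (hN : IsLieCrossedModule ν ψN) (l : L) :
    relations μ ψM ν ψN ≤
      (relations μ ψM ν ψN).comap ((ψM.toEnd l).prodMap (ψN.toEnd l)) := by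
  refine Submodule.span_le.2 ?_
  rintro _ ⟨⟨m, n⟩, rfl⟩
  have h := add_mem (mem_relations (μ := μ) (ψM := ψM) (ν := ν) (ψN := ψN) (ψM.act l m) n)
    (mem_relations (μ := μ) (ψM := ψM) (ν := ν) (ψN := ψN) m (ψN.act l n))
  simpa [hM.equivariant, hN.equivariant, ψM.lie_act, ψN.lie_act] using h

/-- Two morphisms of crossed modules `M → Z` and `N → Z` over `L` jointly kill the relations. -/
theorem relations_le_ker_coprod {Z : Type*} [LieRing Z] [LieAlgebra R Z]
    {z : Z →ₗ⁅R⁆ L} {ψZ : LieAction R L Z} (hZ : IsLieCrossedModule z ψZ)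
    {f : M →ₗ⁅R⁆ Z} {g : N →ₗ⁅R⁆ Z} (hf : IsXModHom μ ψM z ψZ f) (hg : IsXModHom ν ψN z ψZ g) :
    relations μ ψM ν ψN ≤ LinearMap.ker ((f : M →ₗ[R] Z).coprod (g : N →ₗ[R] Z)) := by
  refine Submodule.span_le.2 ?_
  rintro _ ⟨⟨m, n⟩, rfl⟩
  have h : ⁅g n, f m⁆ + ⁅f m, g n⁆ = 0 := by rw [← lie_skew, neg_add_cancel]
  simpa [hf.2, hg.2, ← hf.1, ← hg.1, hZ.peiffer] using h

theorem relations_le_ker_boundary (hM : IsLieCrossedModule μ ψM) (hN : IsLieCrossedModule ν ψN) :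
    relations μ ψM ν ψN ≤ LinearMap.ker ((μ : M →ₗ[R] L).coprod (ν : N →ₗ[R] L)) := by
  refine Submodule.span_le.2 ?_
  rintro _ ⟨⟨m, n⟩, rfl⟩
  have h : ⁅ν n, μ m⁆ + ⁅μ m, ν n⁆ = 0 := by rw [← lie_skew, neg_add_cancel]
  simpa [hM.equivariant, hN.equivariant] using h

/-- The diagonal representation of `L` on the quotient of `M × N` by the relations. -/
def rep (hM : IsLieCrossedModule μ ψM) (hN : IsLieCrossedModule ν ψN) :
    L →ₗ⁅R⁆ Module.End R ((M × N) ⧸ relations μ ψM ν ψN) where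
  toFun l := (relations μ ψM ν ψN).mapQ _ _ (relations_le_comap hM hN l)
  map_add' l l' := by ext <;> simp [← Submodule.Quotient.mk_add]
  map_smul' r l := by ext <;> simp [← Submodule.Quotient.mk_smul]
  map_lie' {l l'} := by
    refine Submodule.linearMap_qext _ (LinearMap.ext fun x => ?_)
    simp [← Submodule.Quotient.mk_sub]

/-- The map `⟨μ, ν⟩` on the quotient of `M × N` by the relations. -/
def boundary (hM : IsLieCrossedModule μ ψM) (hN : IsLieCrossedModule ν ψN) :
    ((M × N) ⧸ relations μ ψM ν ψN) →ₗ[R] L :=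
  (relations μ ψM ν ψN).liftQ _ (relations_le_ker_boundary hM hN)

theorem boundary_rep (hM : IsLieCrossedModule μ ψM) (hN : IsLieCrossedModule ν ψN) (l : L)
    (q : (M × N) ⧸ relations μ ψM ν ψN) :
    boundary hM hN (rep hM hN l q) = ⁅l, boundary hM hN q⁆ := by
  obtain ⟨⟨m, n⟩, rfl⟩ := Submodule.Quotient.mk_surjective _ q
  simp [boundary, rep, hM.equivariant, hN.equivariant]

theorem rep_boundary_self (hM : IsLieCrossedModule μ ψM) (hN : IsLieCrossedModule ν ψN)
    (q : (M × N) ⧸ relations μ ψM ν ψN) : rep hM hN (boundary hM hN q) q = 0 := by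
  obtain ⟨⟨m, n⟩, rfl⟩ := Submodule.Quotient.mk_surjective _ q
  have h := mem_relations (μ := μ) (ψM := ψM) (ν := ν) (ψN := ψN) m n
  simpa [boundary, rep, ψM.add_left, ψN.add_left, hM.peiffer, hN.peiffer,
    Submodule.Quotient.mk_eq_zero] using h

end PeifferProduct

/-- **Binary coproducts of crossed modules of Lie algebras over a fixed base `L` exist,
realized by the Peiffer product** (Theorem 3.4 of the paper).  Given crossed modules
`(μ : M → L, ψM)` and `(ν : N → L, ψN)`, there are a crossed module `(δ : P → L, ψP)`
and morphisms of crossed modules `ιM : M → P`, `ιN : N → P` such that for every crossed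
module `(z : Z → L, ψZ)` (with `Z` in the same universe as `M`, `N`, `L`) and all
morphisms of crossed modules `f : M → Z`, `g : N → Z` there is a unique morphism of
crossed modules `h : P → Z` with `h ∘ ιM = f` and `h ∘ ιN = g`. -/
theorem peifferProduct_is_coproduct_of_crossedModules
    (R : Type u) [CommRing R] (M N L : Type v)
    [LieRing M] [LieAlgebra R M] [LieRing N] [LieAlgebra R N] [LieRing L] [LieAlgebra R L]
    (μ : M →ₗ⁅R⁆ L) (ψM : LieAction R L M) (ν : N →ₗ⁅R⁆ L) (ψN : LieAction R L N)
    (hM : IsLieCrossedModule μ ψM) (hN : IsLieCrossedModule ν ψN) :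
    ∃ (P : Type (max u v)) (_ : LieRing P) (_ : LieAlgebra R P)
      (δ : P →ₗ⁅R⁆ L) (ψP : LieAction R L P)
      (ιM : M →ₗ⁅R⁆ P) (ιN : N →ₗ⁅R⁆ P),
      IsLieCrossedModule δ ψP ∧
      IsXModHom μ ψM δ ψP ιM ∧
      IsXModHom ν ψN δ ψP ιN ∧
      ∀ (Z : Type v) (_ : LieRing Z) (_ : LieAlgebra R Z)
        (z : Z →ₗ⁅R⁆ L) (ψZ : LieAction R L Z), IsLieCrossedModule z ψZ →
        ∀ (f : M →ₗ⁅R⁆ Z) (g : N →ₗ⁅R⁆ Z),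
          IsXModHom μ ψM z ψZ f → IsXModHom ν ψN z ψZ g →
          ∃! h : P →ₗ⁅R⁆ Z,
            IsXModHom δ ψP z ψZ h ∧ h.comp ιM = f ∧ h.comp ιN = g := by
  let K := PeifferProduct.relations μ ψM ν ψN
  let e : ULift.{u} ((M × N) ⧸ K) ≃ₗ[R] (M × N) ⧸ K := ULift.moduleEquiv
  let ρ : L →ₗ⁅R⁆ Module.End R (ULift.{u} ((M × N) ⧸ K)) :=
    (e.symm.lieConj : _ →ₗ⁅R⁆ _).comp (PeifferProduct.rep hM hN)
  let δ : ULift.{u} ((M × N) ⧸ K) →ₗ[R] L := PeifferProduct.boundary hM hN ∘ₗ e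
  have equivariant : ∀ l q, δ (ρ l q) = ⁅l, δ q⁆ := fun l q =>
    PeifferProduct.boundary_rep hM hN l (e q)
  have alternating : ∀ q, ρ (δ q) q = 0 := fun q =>
    congrArg e.symm (PeifferProduct.rep_boundary_self hM hN (e q))
  let _ := PeifferRep.lieRing ρ δ equivariant alternating
  let _ := PeifferRep.lieAlgebra ρ δ equivariant alternating
  have hP := PeifferRep.isLieCrossedModule ρ δ equivariant alternating
  let π : M × N →ₗ[R] ULift.{u} ((M × N) ⧸ K) := e.symm.toLinearMap ∘ₗ K.mkQ
  have δ_π : ∀ x, δ (π x) = μ x.1 + ν x.2 := fun _ => rfl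
  have ρ_π : ∀ l x, ρ l (π x) = π (ψM.act l x.1, ψN.act l x.2) := fun _ _ => rfl
  have hιM : ∀ m, δ (π (m, 0)) = μ m := fun m => by simp [δ_π]
  have hιN : ∀ n, δ (π (0, n)) = ν n := fun n => by simp [δ_π]
  have ρ_ιM : ∀ l m, π (ψM.act l m, 0) = ρ l (π (m, 0)) := fun l m => by
    rw [ρ_π, ← ψN.toEnd_apply, map_zero]
  have ρ_ιN : ∀ l n, π (0, ψN.act l n) = ρ l (π (0, n)) := fun l n => by
    rw [ρ_π, ← ψM.toEnd_apply, map_zero]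
  refine ⟨ULift.{u} ((M × N) ⧸ K), inferInstance, inferInstance,
    PeifferRep.boundary ρ δ equivariant alternating,
    PeifferRep.action ρ δ equivariant alternating,
    hM.lieHomOfLinear hP (π ∘ₗ LinearMap.inl R M N) hιM ρ_ιM,
    hN.lieHomOfLinear hP (π ∘ₗ LinearMap.inr R M N) hιN ρ_ιN,
    hP, ⟨hιM, ρ_ιM⟩, ⟨hιN, ρ_ιN⟩, ?_⟩
  intro Z _ _ z ψZ hZ f g hf hg
  have surj : ∀ p, ∃ m n, π (m, n) = p := fun p => by
    obtain ⟨⟨m, n⟩, h⟩ := K.mkQ_surjective (e p)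
    exact ⟨m, n, congrArg e.symm h⟩
  let h₀ : ULift.{u} ((M × N) ⧸ K) →ₗ[R] Z :=
    K.liftQ _ (PeifferProduct.relations_le_ker_coprod hZ hf hg) ∘ₗ e.toLinearMap
  have h₀_π : ∀ m n, h₀ (π (m, n)) = f m + g n := fun _ _ => rfl
  have hd : ∀ p, z (h₀ p) = δ p := fun p => by
    obtain ⟨m, n, rfl⟩ := surj p
    rw [h₀_π, δ_π, map_add, hf.1, hg.1]
  have hψ : ∀ l p, h₀ (ρ l p) = ψZ.act l (h₀ p) := fun l p => by
    obtain ⟨m, n, rfl⟩ := surj p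
    rw [ρ_π, h₀_π, h₀_π, ψZ.add_right, hf.2, hg.2]
  refine ⟨hP.lieHomOfLinear hZ h₀ hd hψ, ⟨⟨hd, hψ⟩, ?_, ?_⟩, ?_⟩
  · ext m
    change h₀ (π (m, 0)) = f m
    rw [h₀_π, map_zero, add_zero]
  · ext n
    change h₀ (π (0, n)) = g n
    rw [h₀_π, map_zero, zero_add]
  · rintro h ⟨-, rfl, rfl⟩
    ext p
    obtain ⟨m, n, rfl⟩ := surj p
    have hmn : π (m, n) = π (m, 0) + π (0, n) := by
      rw [← map_add, Prod.mk_add_mk, add_zero, zero_add]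
    change h (π (m, n)) = h (π (m, 0)) + h (π (0, n))
    rw [hmn]
    exact map_add h _ _
end
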